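/- Let y = v_j be a vertex and x ∈ [v_1, v_n] a point with y < x, and let v_a, v_b be vertices with y < v_a < v_b < x. Let s be any scenario and let δ > 0 satisfy w_a^s + δ ≤ w_a^+ and w_b^s − δ ≥ w_b^−. Let s' be the scenario obtained from s by replacing w_a^s with w_a^s + δ and w_b^s with w_b^s − δ. Then Φ^{s'}(x) ≥ Φ^{s}(x) and Φ^{s'}(y) ≤ Φ^{s}(y), and consequently Γ^{s'}(x, y) ≥ Γ^{s}(x, y). -/

import Mathlib

open Finset
open scoped Classical

namespace DPN

noncomputable def score (τ c : ℝ) (v w : ℕ → ℝ) (h r j : ℕ) : ℝ :=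
  τ * (v h - v j) + (∑ l ∈ Finset.Ioc r j, w l) / c

noncomputable def nextHead (τ c : ℝ) (v w : ℕ → ℝ) (h r : ℕ) : ℕ :=
  (((Finset.Ioc r h).filter (fun j =>
      ∀ j' ∈ Finset.Ioc r h, score τ c v w h r j' ≤ score τ c v w h r j)).max).getD h

noncomputable def heads (τ c : ℝ) (v w : ℕ → ℝ) (h : ℕ) : ℕ → ℕ
  | 0 => 0
  | m + 1 => nextHead τ c v w h (heads τ c v w h m)

noncomputable def hIdx (n : ℕ) (v : ℕ → ℝ) (x : ℝ) : ℕ :=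
  ((Finset.Icc 1 n).filter (fun i => v i < x)).card

noncomputable def phiL (n : ℕ) (τ c : ℝ) (v w : ℕ → ℝ) (x : ℝ) : ℝ :=
  ∑ m ∈ Finset.range n,
    ((∑ l ∈ Finset.Ioc (heads τ c v w (hIdx n v x) m) (heads τ c v w (hIdx n v x) (m + 1)), w l) *
        (τ * (x - v (heads τ c v w (hIdx n v x) (m + 1)))) +
      (∑ l ∈ Finset.Ioc (heads τ c v w (hIdx n v x) m) (heads τ c v w (hIdx n v x) (m + 1)), w l) ^ 2 /
        (2 * c))

def rv (n : ℕ) (v : ℕ → ℝ) : ℕ → ℝ := fun l => -v (n + 1 - l)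

def rw (n : ℕ) (w : ℕ → ℝ) : ℕ → ℝ := fun l => w (n + 1 - l)

noncomputable def phiR (n : ℕ) (τ c : ℝ) (v w : ℕ → ℝ) (x : ℝ) : ℝ :=
  phiL n τ c (rv n v) (rw n w) (-x)

noncomputable def phi (n : ℕ) (τ c : ℝ) (v w : ℕ → ℝ) (x : ℝ) : ℝ :=
  phiL n τ c v w x + phiR n τ c v w x

/-- The set of scenarios: each vertex weight lies in its interval. -/
def scenarios (n : ℕ) (wm wp : ℕ → ℝ) : Set (ℕ → ℝ) :=
  {s | ∀ i, 1 ≤ i → i ≤ n → wm i ≤ s i ∧ s i ≤ wp i}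

/-- The gap `Γ^s(x, y) = Φ^s(x) − Φ^s(y)`. -/
noncomputable def gap (n : ℕ) (τ c : ℝ) (v s : ℕ → ℝ) (x y : ℝ) : ℝ :=
  phi n τ c v s x - phi n τ c v s y

/-- The regret `R^s(x) = Φ^s(x) − Φ^s(m^s)` (`Φ^s(m^s)` = min of `Φ^s` on `[v_1, v_n]`). -/
noncomputable def regret (n : ℕ) (τ c : ℝ) (v s : ℕ → ℝ) (x : ℝ) : ℝ :=
  phi n τ c v s x - sInf ((fun z => phi n τ c v s z) '' Set.Icc (v 1) (v n))

/-- The maximum regret `R_max(x) = sup_{s ∈ S} R^s(x)`. -/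
noncomputable def maxRegret (n : ℕ) (τ c : ℝ) (v wm wp : ℕ → ℝ) (x : ℝ) : ℝ :=
  sSup {r | ∃ s ∈ scenarios n wm wp, r = regret n τ c v s x}

/-- The left-pseudo-bipartite scenario `s(i, w)`. -/
def pseudoBipL (wm wp : ℕ → ℝ) (i : ℕ) (w : ℝ) : ℕ → ℝ :=
  fun l => if l < i then wp l else if l = i then w else wm l

/-- The right-pseudo-bipartite scenario `s(i, w)`. -/
def pseudoBipR (wm wp : ℕ → ℝ) (i : ℕ) (w : ℝ) : ℕ → ℝ :=
  fun l => if l < i then wm l else if l = i then w else wp l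

/-- The head `ρ_m` of the left cluster containing vertex `i`: the smallest cluster head `≥ i`. -/
noncomputable def clusterHeadOf (τ c : ℝ) (v w : ℕ → ℝ) (h i : ℕ) : ℕ :=
  ((((Finset.range (h + 1)).image (heads τ c v w h)).filter (fun r => i ≤ r)).min).getD h

/-- The head `ρ_{m−1}` preceding the left cluster containing vertex `i`:
the largest cluster head `< i`. -/
noncomputable def prevClusterHeadOf (τ c : ℝ) (v w : ℕ → ℝ) (h i : ℕ) : ℕ :=
  ((((Finset.range (h + 1)).image (heads τ c v w h)).filter (fun r => r < i)).max).getD 0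

/-- The weight `σ_m` of the left cluster containing vertex `i`. -/
noncomputable def clusterWeightOf (τ c : ℝ) (v w : ℕ → ℝ) (h i : ℕ) : ℝ :=
  ∑ l ∈ Finset.Ioc (prevClusterHeadOf τ c v w h i) (clusterHeadOf τ c v w h i), w l

/-- The sequence of right cluster heads for the vertex `y = v_j`
(expressed in the coordinates of the reflected network). -/
noncomputable def rightHeads (n : ℕ) (τ c : ℝ) (v w : ℕ → ℝ) (j : ℕ) : ℕ → ℕ :=
  heads τ c (rv n v) (rw n w) (hIdx n (rv n v) (-(v j)))

/-- The sequence of left cluster heads for the vertex `y = v_j`. -/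
noncomputable def leftHeads (n : ℕ) (τ c : ℝ) (v w : ℕ → ℝ) (j : ℕ) : ℕ → ℕ :=
  heads τ c v w (hIdx n v (v j))

/-- The (original-coordinates) index of the head of the right cluster for `y = v_j`
containing vertex `i`. -/
noncomputable def rightClusterHeadOf (n : ℕ) (τ c : ℝ) (v w : ℕ → ℝ) (j i : ℕ) : ℕ :=
  n + 1 - clusterHeadOf τ c (rv n v) (rw n w) (hIdx n (rv n v) (-(v j))) (n + 1 - i)

/-- The weight of the right cluster for `y = v_j` containing vertex `i`. -/
noncomputable def rightClusterWeightOf (n : ℕ) (τ c : ℝ) (v w : ℕ → ℝ) (j i : ℕ) : ℝ :=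
  clusterWeightOf τ c (rv n v) (rw n w) (hIdx n (rv n v) (-(v j))) (n + 1 - i)

/-- `ω` is a critical weight for `v_i` with respect to the vertex `y = v_j`
(left-pseudo-bipartite case): `ω ∈ {w_i^−, w_i^+}` or the right-cluster partition for `y`
under `s(i, ·)` is not constant on any neighborhood of `ω` in `[w_i^−, w_i^+]`. -/
def criticalWeightL (n : ℕ) (τ c : ℝ) (v wm wp : ℕ → ℝ) (j i : ℕ) (ω : ℝ) : Prop :=
  ω ∈ Set.Icc (wm i) (wp i) ∧
    (ω = wm i ∨ ω = wp i ∨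
      ¬ ∃ ε > (0 : ℝ), ∀ w ∈ Set.Icc (wm i) (wp i), |w - ω| < ε →
        rightHeads n τ c v (pseudoBipL wm wp i w) j =
          rightHeads n τ c v (pseudoBipL wm wp i ω) j)

/-- `ω` is a critical weight for `v_i` with respect to the vertex `y = v_j`
(right-pseudo-bipartite case, using the left-cluster partition for `y`). -/
def criticalWeightR (n : ℕ) (τ c : ℝ) (v wm wp : ℕ → ℝ) (j i : ℕ) (ω : ℝ) : Prop :=
  ω ∈ Set.Icc (wm i) (wp i) ∧
    (ω = wm i ∨ ω = wp i ∨
      ¬ ∃ ε > (0 : ℝ), ∀ w ∈ Set.Icc (wm i) (wp i), |w - ω| < ε →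
        leftHeads n τ c v (pseudoBipR wm wp i w) j =
          leftHeads n τ c v (pseudoBipR wm wp i ω) j)

/-- `Q`: the number of right clusters for `y = v_j` under weights `w` that lie entirely
to the right of the right cluster containing `v_i` (counted via reflected cluster heads). -/
noncomputable def Qnum (n : ℕ) (τ c : ℝ) (v w : ℕ → ℝ) (j i : ℕ) : ℕ :=
  (((Finset.range (n + 1)).image (rightHeads n τ c v w j)).filter
      (fun r => 1 ≤ r ∧
        r < clusterHeadOf τ c (rv n v) (rw n w) (hIdx n (rv n v) (-(v j))) (n + 1 - i))).card

end DPN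

open DPN

namespace DPN

/-- The weight of the first `k` vertices. -/
noncomputable def prefixWeight (w : ℕ → ℝ) (k : ℕ) : ℝ :=
  ∑ l ∈ Finset.Ioc 0 k, w l

lemma sum_Ioc_eq_prefixWeight_sub (w : ℕ → ℝ) {r k : ℕ} (hrk : r ≤ k) :
    ∑ l ∈ Finset.Ioc r k, w l = prefixWeight w k - prefixWeight w r := by
  rw [prefixWeight, prefixWeight, eq_sub_iff_add_eq, add_comm,
    Finset.sum_Ioc_consecutive _ (Nat.zero_le r) hrk]

lemma prefixWeight_le {w : ℕ → ℝ} {h : ℕ} (hw : ∀ i ∈ Finset.Icc 1 h, 0 ≤ w i) {r k : ℕ}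
    (hrk : r ≤ k) (hkh : k ≤ h) : prefixWeight w r ≤ prefixWeight w k := by
  rw [← sub_nonneg, ← sum_Ioc_eq_prefixWeight_sub w hrk]
  refine Finset.sum_nonneg fun i hi => hw i ?_
  rw [Finset.mem_Ioc] at hi
  rw [Finset.mem_Icc]
  omega

section Heads

variable (τ c : ℝ) (v w : ℕ → ℝ) {h : ℕ}

lemma nextHead_spec {r : ℕ} (hr : r < h) :
    nextHead τ c v w h r ∈ Finset.Ioc r h ∧
      ∀ j ∈ Finset.Ioc r h, score τ c v w h r j ≤ score τ c v w h r (nextHead τ c v w h r) := by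
  set F := (Finset.Ioc r h).filter (fun j =>
      ∀ j' ∈ Finset.Ioc r h, score τ c v w h r j' ≤ score τ c v w h r j) with hF
  have hne : F.Nonempty := by
    obtain ⟨j, hj, hmax⟩ := Finset.exists_max_image (Finset.Ioc r h) (score τ c v w h r)
      ⟨h, Finset.mem_Ioc.2 ⟨hr, le_rfl⟩⟩
    exact ⟨j, Finset.mem_filter.2 ⟨hj, hmax⟩⟩
  obtain ⟨k, hk⟩ := Finset.max_of_nonempty hne
  have hnext : nextHead τ c v w h r = k := by
    unfold nextHead
    rw [← hF, hk]
    rfl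
  rw [hnext]
  exact Finset.mem_filter.1 (Finset.mem_of_max hk)

lemma nextHead_self : nextHead τ c v w h h = h := by
  simp only [nextHead, Finset.Ioc_self, Finset.filter_empty, Finset.max_empty]
  rfl

lemma heads_le (m : ℕ) : heads τ c v w h m ≤ h := by
  induction m with
  | zero => exact Nat.zero_le h
  | succ m ih =>
    rcases ih.lt_or_eq with hlt | heq
    · exact (Finset.mem_Ioc.1 (nextHead_spec τ c v w hlt).1).2
    · rw [heads, heq, nextHead_self]

lemma heads_le_heads_succ (m : ℕ) : heads τ c v w h m ≤ heads τ c v w h (m + 1) := by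
  rcases (heads_le τ c v w (h := h) m).lt_or_eq with hlt | heq
  · exact (Finset.mem_Ioc.1 (nextHead_spec τ c v w hlt).1).1.le
  · rw [heads, heq, nextHead_self]

lemma min_le_heads (m : ℕ) : min m h ≤ heads τ c v w h m := by
  induction m with
  | zero => simp
  | succ m ih =>
    rcases (heads_le τ c v w (h := h) m).lt_or_eq with hlt | heq
    · have := (Finset.mem_Ioc.1 (nextHead_spec (h := h) τ c v w hlt).1).1
      rw [heads]
      omega
    · rw [heads, heq, nextHead_self]
      omega

lemma heads_eq_of_le {m : ℕ} (hm : h ≤ m) : heads τ c v w h m = h :=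
  le_antisymm (heads_le τ c v w m) (by simpa [hm] using min_le_heads τ c v w (h := h) m)

end Heads

/-- The candidate arrival times at `x` of the unit of flow that has weight `t` on its far side:
one for each vertex up to `h` that the unit passes. -/
def arrivalSet (τ c : ℝ) (v w : ℕ → ℝ) (h : ℕ) (x t : ℝ) : Set ℝ :=
  (fun j => τ * (x - v j) + (prefixWeight w j - t) / c) ''
    {j | j ∈ Finset.Icc 1 h ∧ t ≤ prefixWeight w j}

/-- The arrival time at `x` of the unit of flow that has weight `t` on its far side. -/
noncomputable def arrival (τ c : ℝ) (v w : ℕ → ℝ) (h : ℕ) (x t : ℝ) : ℝ :=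
  sSup (arrivalSet τ c v w h x t)

lemma bddAbove_arrivalSet (τ c : ℝ) (v w : ℕ → ℝ) (h : ℕ) (x t : ℝ) :
    BddAbove (arrivalSet τ c v w h x t) :=
  (((Finset.Icc 1 h).finite_toSet.subset fun _ hj => hj.1).image _).bddAbove

lemma arrival_le_arrival {τ c : ℝ} (hc : 0 < c) {v w w' : ℕ → ℝ} {h : ℕ} {x t : ℝ}
    (hle : ∀ k ≤ h, prefixWeight w k ≤ prefixWeight w' k)
    (ht0 : 0 < t) (ht : t ≤ prefixWeight w h) :
    arrival τ c v w h x t ≤ arrival τ c v w' h x t := by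
  have h1 : 1 ≤ h := by
    by_contra! h0
    obtain rfl : h = 0 := by omega
    simp only [prefixWeight, Finset.Ioc_self, Finset.sum_empty] at ht
    linarith
  refine csSup_le ⟨_, h, ⟨Finset.mem_Icc.2 ⟨h1, le_rfl⟩, ht⟩, rfl⟩ ?_
  rintro _ ⟨k, ⟨hk, htk⟩, rfl⟩
  have hkk := hle k (Finset.mem_Icc.1 hk).2
  refine le_csSup_of_le (bddAbove_arrivalSet ..) ⟨k, ⟨hk, htk.trans hkk⟩, rfl⟩ ?_
  dsimp only
  gcongr

/-- Inside a cluster, the arrival time is determined by the head of the cluster. -/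
lemma arrival_eq_of_mem_cluster {τ c : ℝ} {v w : ℕ → ℝ} {h : ℕ}
    (hw : ∀ i ∈ Finset.Icc 1 h, 0 ≤ w i) (x : ℝ) (m : ℕ) {t : ℝ}
    (ht : t ∈ Set.Ioc (prefixWeight w (heads τ c v w h m))
      (prefixWeight w (heads τ c v w h (m + 1)))) :
    τ * (x - v (heads τ c v w h (m + 1))) + (prefixWeight w (heads τ c v w h (m + 1)) - t) / c =
      arrival τ c v w h x t := by
  rcases (heads_le τ c v w (h := h) m).lt_or_eq with hlt | heq
  swap
  · rw [heads, heq, nextHead_self] at ht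
    exact absurd (ht.1.trans_le ht.2) (lt_irrefl _)
  obtain ⟨hmem, hmax⟩ := nextHead_spec τ c v w hlt
  rw [heads] at ht ⊢
  set r := heads τ c v w h m
  set k := nextHead τ c v w h r
  rw [Finset.mem_Ioc] at hmem
  symm
  refine IsGreatest.csSup_eq ⟨⟨k, ⟨Finset.mem_Icc.2 ⟨by omega, hmem.2⟩, ht.2⟩, rfl⟩, ?_⟩
  rintro _ ⟨i, ⟨hi, hti⟩, rfl⟩
  rw [Finset.mem_Icc] at hi
  have hri : r < i := by
    by_contra! hir
    exact absurd (ht.1.trans_le (hti.trans (prefixWeight_le hw hir hlt.le))) (lt_irrefl _)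
  have hscore := hmax i (Finset.mem_Ioc.2 ⟨hri, hi.2⟩)
  rw [score, score, sum_Ioc_eq_prefixWeight_sub w hri.le,
    sum_Ioc_eq_prefixWeight_sub w hmem.1.le] at hscore
  simp only [sub_div, mul_sub] at hscore ⊢
  linarith

lemma integral_cluster_arrival {c : ℝ} (d p q : ℝ) :
    ∫ t in p..q, (d + (q - t) / c) = (q - p) * d + (q - p) ^ 2 / (2 * c) := by
  have hderiv : ∀ t ∈ Set.uIcc p q,
      HasDerivAt (fun t => t * d - (q - t) ^ 2 / (2 * c)) (d + (q - t) / c) t := by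
    intro t _
    refine (((hasDerivAt_id' t).mul_const d).sub
      ((((hasDerivAt_id' t).const_sub q).pow 2).div_const (2 * c))).congr_deriv ?_
    push_cast
    ring
  rw [intervalIntegral.integral_eq_sub_of_hasDerivAt hderiv
    (Continuous.intervalIntegrable (by fun_prop) _ _)]
  ring

section Integral

variable {τ c : ℝ} {v w : ℕ → ℝ} {n : ℕ} {x : ℝ}

lemma intervalIntegrable_arrival_cluster {h : ℕ} (hw : ∀ i ∈ Finset.Icc 1 h, 0 ≤ w i) (m : ℕ) :
    IntervalIntegrable (arrival τ c v w h x) MeasureTheory.volume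
      (prefixWeight w (heads τ c v w h m)) (prefixWeight w (heads τ c v w h (m + 1))) := by
  have hle := prefixWeight_le hw (heads_le_heads_succ τ c v w m) (heads_le τ c v w (m + 1))
  refine IntervalIntegrable.congr (f := fun t => τ * (x - v (heads τ c v w h (m + 1))) +
    (prefixWeight w (heads τ c v w h (m + 1)) - t) / c) ?_
    (Continuous.intervalIntegrable (by fun_prop) _ _)
  rw [Set.uIoc_of_le hle]
  exact fun t ht => arrival_eq_of_mem_cluster hw x m ht

lemma intervalIntegrable_arrival {h : ℕ} (hw : ∀ i ∈ Finset.Icc 1 h, 0 ≤ w i) :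
    IntervalIntegrable (arrival τ c v w h x) MeasureTheory.volume 0 (prefixWeight w h) := by
  have := IntervalIntegrable.trans_iterate (n := h)
    (a := fun m => prefixWeight w (heads τ c v w h m))
    fun m _ => intervalIntegrable_arrival_cluster (τ := τ) (c := c) (v := v) (x := x) hw m
  simpa [heads_eq_of_le, heads, prefixWeight] using this

lemma hIdx_le : hIdx n v x ≤ n :=
  (Finset.card_filter_le _ _).trans (by simp)

/-- The left evacuation time is the integral of the arrival times. -/
lemma phiL_eq_integral (hw : ∀ i ∈ Finset.Icc 1 (hIdx n v x), 0 ≤ w i) :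
    phiL n τ c v w x =
      ∫ t in 0..prefixWeight w (hIdx n v x), arrival τ c v w (hIdx n v x) x t := by
  have hn : hIdx n v x ≤ n := hIdx_le
  rw [phiL]
  set h := hIdx n v x
  have hsum := intervalIntegral.sum_integral_adjacent_intervals (n := n)
    (a := fun m => prefixWeight w (heads τ c v w h m))
    fun m _ => intervalIntegrable_arrival_cluster (τ := τ) (c := c) (v := v) (x := x) hw m
  have h0 : prefixWeight w (heads τ c v w h 0) = 0 := by simp [heads, prefixWeight]
  rw [heads_eq_of_le τ c v w hn, h0] at hsum
  rw [← hsum]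
  refine Finset.sum_congr rfl fun m _ => ?_
  have hmono := heads_le_heads_succ τ c v w (h := h) m
  rw [sum_Ioc_eq_prefixWeight_sub w hmono, ← integral_cluster_arrival]
  refine intervalIntegral.integral_congr_ae (.of_forall ?_)
  rw [Set.uIoc_of_le (prefixWeight_le hw hmono (heads_le τ c v w (m + 1)))]
  exact fun t ht => arrival_eq_of_mem_cluster hw x m ht

/-- The left evacuation time is monotone in the prefix weights, for a fixed total weight. -/
lemma phiL_le_of_prefixWeight_le {w' : ℕ → ℝ} (hc : 0 < c)
    (hw : ∀ i ∈ Finset.Icc 1 (hIdx n v x), 0 ≤ w i)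
    (hw' : ∀ i ∈ Finset.Icc 1 (hIdx n v x), 0 ≤ w' i)
    (hle : ∀ k ≤ hIdx n v x, prefixWeight w k ≤ prefixWeight w' k)
    (heq : prefixWeight w (hIdx n v x) = prefixWeight w' (hIdx n v x)) :
    phiL n τ c v w x ≤ phiL n τ c v w' x := by
  have h0 : 0 ≤ prefixWeight w (hIdx n v x) := by
    simpa [prefixWeight] using prefixWeight_le hw (Nat.zero_le _) le_rfl
  rw [phiL_eq_integral hw, phiL_eq_integral hw', ← heq]
  refine intervalIntegral.integral_mono_on_of_le_Ioo h0 (intervalIntegrable_arrival hw)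
    (heq ▸ intervalIntegrable_arrival hw') fun t ht => ?_
  exact arrival_le_arrival hc hle ht.1 ht.2.le

/-- Moving weight `δ` from vertex `b` to the farther vertex `a` does not decrease the left
evacuation time. -/
lemma phiL_le_of_move {w' : ℕ → ℝ} (hc : 0 < c) {a b : ℕ} {δ : ℝ} (hδ : 0 ≤ δ)
    (hw : ∀ i ∈ Finset.Icc 1 (hIdx n v x), 0 ≤ w i)
    (hw' : ∀ i ∈ Finset.Icc 1 (hIdx n v x), 0 ≤ w' i)
    (ha : 1 ≤ a) (hab : a ≤ b) (hb : b ≤ hIdx n v x)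
    (hmove : ∀ i ∈ Finset.Icc 1 (hIdx n v x),
      w' i = w i + (if i = a then δ else 0) - (if i = b then δ else 0)) :
    phiL n τ c v w x ≤ phiL n τ c v w' x := by
  have key : ∀ k ≤ hIdx n v x, prefixWeight w' k =
      prefixWeight w k + (if a ≤ k then δ else 0) - (if b ≤ k then δ else 0) := by
    intro k hk
    rw [prefixWeight, prefixWeight, Finset.sum_congr rfl fun i hi => hmove i
      (Finset.mem_Icc.2 ⟨(Finset.mem_Ioc.1 hi).1, (Finset.mem_Ioc.1 hi).2.trans hk⟩),
      Finset.sum_sub_distrib, Finset.sum_add_distrib, Finset.sum_ite_eq', Finset.sum_ite_eq']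
    simp [show 0 < a by omega, show 0 < b by omega]
  refine phiL_le_of_prefixWeight_le hc hw hw' (fun k hk => ?_) ?_
  · rw [key k hk]
    split_ifs <;> first | omega | linarith
  · rw [key _ le_rfl, if_pos (hab.trans hb), if_pos hb]
    ring

lemma phiL_congr {w' : ℕ → ℝ} (hc : 0 < c)
    (hw : ∀ i ∈ Finset.Icc 1 (hIdx n v x), 0 ≤ w i)
    (hww : ∀ i ∈ Finset.Icc 1 (hIdx n v x), w i = w' i) :
    phiL n τ c v w x = phiL n τ c v w' x := by
  have hw' : ∀ i ∈ Finset.Icc 1 (hIdx n v x), 0 ≤ w' i := fun i hi => hww i hi ▸ hw i hi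
  have key : ∀ k ≤ hIdx n v x, prefixWeight w k = prefixWeight w' k := fun k hk =>
    Finset.sum_congr rfl fun i hi => hww i
      (Finset.mem_Icc.2 ⟨(Finset.mem_Ioc.1 hi).1, (Finset.mem_Ioc.1 hi).2.trans hk⟩)
  exact le_antisymm
    (phiL_le_of_prefixWeight_le hc hw hw' (fun k hk => (key k hk).le) (key _ le_rfl))
    (phiL_le_of_prefixWeight_le hc hw' hw (fun k hk => (key k hk).ge) (key _ le_rfl).symm)

lemma le_hIdx {k : ℕ} (hk : k ≤ n) (h : ∀ i, 1 ≤ i → i ≤ k → v i < x) : k ≤ hIdx n v x := by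
  have hsub : Finset.Icc 1 k ⊆ (Finset.Icc 1 n).filter (fun i => v i < x) := fun i hi => by
    rw [Finset.mem_Icc] at hi
    exact Finset.mem_filter.2 ⟨Finset.mem_Icc.2 ⟨hi.1, hi.2.trans hk⟩, h i hi.1 hi.2⟩
  simpa [hIdx] using Finset.card_le_card hsub

lemma hIdx_le_of_forall {k : ℕ} (h : ∀ i, 1 ≤ i → i ≤ n → v i < x → i ≤ k) :
    hIdx n v x ≤ k := by
  have hsub : (Finset.Icc 1 n).filter (fun i => v i < x) ⊆ Finset.Icc 1 k := fun i hi => by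
    rw [Finset.mem_filter, Finset.mem_Icc] at hi
    exact Finset.mem_Icc.2 ⟨hi.1.1, h i hi.1.1 hi.1.2 hi.2⟩
  simpa [hIdx] using Finset.card_le_card hsub

end Integral

end DPN

theorem stmt10 (n : ℕ) (τ c : ℝ) (hτ : 0 < τ) (hc : 0 < c) (v : ℕ → ℝ)
    (hv : ∀ i, 1 ≤ i → i < n → v i < v (i + 1))
    (wm wp : ℕ → ℝ) (hwm : ∀ i, 1 ≤ i → i ≤ n → 0 < wm i)
    (hwmp : ∀ i, 1 ≤ i → i ≤ n → wm i ≤ wp i)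
    (j : ℕ) (hj1 : 1 ≤ j) (hjn : j ≤ n)
    (x : ℝ) (hx : x ∈ Set.Icc (v 1) (v n))
    (a b : ℕ) (ha1 : 1 ≤ a) (han : a ≤ n) (hb1 : 1 ≤ b) (hbn : b ≤ n)
    (hya : v j < v a) (hab : v a < v b) (hbx : v b < x)
    (s : ℕ → ℝ) (hs : s ∈ scenarios n wm wp)
    (δ : ℝ) (hδ : 0 < δ) (hsa : s a + δ ≤ wp a) (hsb : wm b ≤ s b - δ)
    (s' : ℕ → ℝ)
    (hs' : s' = Function.update (Function.update s a (s a + δ)) b (s b - δ)) :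
    phi n τ c v s x ≤ phi n τ c v s' x ∧
      phi n τ c v s' (v j) ≤ phi n τ c v s (v j) ∧
      gap n τ c v s x (v j) ≤ gap n τ c v s' x (v j) := by
  have hmono : StrictMonoOn v (Set.Icc 1 n) :=
    strictMonoOn_of_lt_add_one Set.ordConnected_Icc fun i _ hi hi' => hv i hi.1 hi'.2
  have ja : j < a := (hmono.lt_iff_lt ⟨hj1, hjn⟩ ⟨ha1, han⟩).1 hya
  have ab : a < b := (hmono.lt_iff_lt ⟨ha1, han⟩ ⟨hb1, hbn⟩).1 hab
  have hmove : ∀ i, s' i = s i + (if i = a then δ else 0) - (if i = b then δ else 0) := by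
    intro i
    rw [hs']
    rcases eq_or_ne i b with rfl | hib
    · simp [ab.ne']
    · rcases eq_or_ne i a with rfl | hia
      · simp [hib]
      · simp [hib, hia]
  have hpos : ∀ i, 1 ≤ i → i ≤ n → 0 ≤ s i := fun i h1 hi =>
    (hwm i h1 hi).le.trans (hs i h1 hi).1
  have hpos' : ∀ i, 1 ≤ i → i ≤ n → 0 ≤ s' i := by
    intro i h1 hi
    have := hpos i h1 hi
    have := hwm b hb1 hbn
    rw [hmove]
    split_ifs <;> subst_vars <;> linarith
  have hL (z : ℝ) {i : ℕ} (hi : i ∈ Finset.Icc 1 (hIdx n v z)) : 1 ≤ i ∧ i ≤ n := by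
    rw [Finset.mem_Icc] at hi
    exact ⟨hi.1, hi.2.trans hIdx_le⟩
  have hR (z : ℝ) {i : ℕ} (hi : i ∈ Finset.Icc 1 (hIdx n (rv n v) z)) :
      1 ≤ n + 1 - i ∧ n + 1 - i ≤ n := by
    rw [Finset.mem_Icc] at hi
    have := hIdx_le (n := n) (v := rv n v) (x := z)
    omega
  have hbIdx : b ≤ hIdx n v x := le_hIdx hbn fun i h1 hi =>
    (hmono.monotoneOn ⟨h1, hi.trans hbn⟩ ⟨hb1, hbn⟩ hi).trans_lt hbx
  have hjIdx : hIdx n v (v j) ≤ j := hIdx_le_of_forall fun i h1 hi hlt =>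
    ((hmono.lt_iff_lt ⟨h1, hi⟩ ⟨hj1, hjn⟩).1 hlt).le
  have hxIdx : hIdx n (rv n v) (-x) ≤ n - b := hIdx_le_of_forall fun i h1 hi hlt => by
    have hlt' : v b < v (n + 1 - i) := hbx.trans (neg_lt_neg_iff.1 hlt)
    have := (hmono.lt_iff_lt ⟨hb1, hbn⟩ ⟨by omega, by omega⟩).1 hlt'
    omega
  have haIdx : n + 1 - a ≤ hIdx n (rv n v) (-(v j)) := le_hIdx (by omega) fun i h1 hi =>
    neg_lt_neg (hya.trans_le
      (hmono.monotoneOn ⟨ha1, han⟩ ⟨by omega, by omega⟩ (by omega)))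
  have hΦx : phi n τ c v s x ≤ phi n τ c v s' x := by
    refine add_le_add (phiL_le_of_move hc hδ.le (fun i hi => hpos i (hL x hi).1 (hL x hi).2)
      (fun i hi => hpos' i (hL x hi).1 (hL x hi).2) ha1 ab.le hbIdx fun i _ => hmove i) ?_
    refine (phiL_congr hc (fun i hi => hpos _ (hR _ hi).1 (hR _ hi).2) fun i hi => ?_).le
    have hi' := Finset.mem_Icc.1 hi
    simp [DPN.rw, hmove, show n + 1 - i ≠ a by omega, show n + 1 - i ≠ b by omega]
  have hΦy : phi n τ c v s' (v j) ≤ phi n τ c v s (v j) := by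
    refine add_le_add ?_ ?_
    · refine (phiL_congr hc (fun i hi => hpos' i (hL _ hi).1 (hL _ hi).2) fun i hi => ?_).le
      have hi' := Finset.mem_Icc.1 hi
      simp [hmove, show i ≠ a by omega, show i ≠ b by omega]
    · refine phiL_le_of_move (a := n + 1 - b) (b := n + 1 - a) hc hδ.le
        (fun i hi => hpos' _ (hR _ hi).1 (hR _ hi).2) (fun i hi => hpos _ (hR _ hi).1 (hR _ hi).2)
        (by omega) (by omega) haIdx fun i hi => ?_
      have hi' := hR _ hi
      have hia : i = n + 1 - a ↔ n + 1 - i = a := by omega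
      have hib : i = n + 1 - b ↔ n + 1 - i = b := by omega
      simp only [DPN.rw, hmove, hia, hib]
      ring
  exact ⟨hΦx, hΦy, sub_le_sub hΦx hΦy⟩
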